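/- No identifier-independent, unbounded, filter-based semantics is ·-composable: if a semantics S is filter-based, identifier-independent and unbounded, then there exist a database D and regular expressions R, R′ such that S(D,R) · S(D,R′) is not a subset of S(D, R·R′). -/

import Mathlib

namespace RPQ

/-- Vertex identifiers. -/
abbrev V : Type := ℕ
/-- Edge identifiers. -/
abbrev Edg : Type := ℕ
/-- Labels. -/
abbrev Lab : Type := ℕ

/-- A walk: a nonempty alternating sequence `v₀,e₁,v₁,…,e_k,v_k`, encoded as the
initial vertex together with the list of (edge, next-vertex) pairs. -/
structure Walk where
  head : V
  steps : List (Edg × V)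
deriving DecidableEq

namespace Walk

def length (w : Walk) : ℕ := w.steps.length
def src (w : Walk) : V := w.head
def tgt (w : Walk) : V := (w.steps.map Prod.snd).getLastD w.head
/-- The pair of endpoints of a walk. -/
def ep (w : Walk) : V × V := (w.src, w.tgt)
def vertexList (w : Walk) : List V := w.head :: w.steps.map Prod.snd
def edgeList (w : Walk) : List Edg := w.steps.map Prod.fst
/-- Concatenation of walks (meaningful when `w.tgt = w'.src`). -/
def concat (w w' : Walk) : Walk := ⟨w.head, w.steps ++ w'.steps⟩

end Walk

/-- A graph database. -/
structure Database where
  labels : Finset Lab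
  verts : Finset V
  edges : Finset Edg
  src : Edg → V
  tgt : Edg → V
  lbl : Edg → Lab
  src_mem : ∀ e ∈ edges, src e ∈ verts
  tgt_mem : ∀ e ∈ edges, tgt e ∈ verts
  lbl_mem : ∀ e ∈ edges, lbl e ∈ labels

def chainFrom (D : Database) : V → List (Edg × V) → Prop
  | _, [] => True
  | v, (e, v') :: rest =>
      e ∈ D.edges ∧ D.src e = v ∧ D.tgt e = v' ∧ chainFrom D v' rest

/-- `w` is consistent with `D`, i.e. `w` is a walk in `D`. -/
def Walk.Consistent (D : Database) (w : Walk) : Prop :=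
  w.head ∈ D.verts ∧ chainFrom D w.head w.steps

/-- The set of walks in `D`. -/
def Walks (D : Database) : Set Walk := {w | w.Consistent D}

/-- The label of a walk in `D`: the word of its successive edge labels. -/
def Walk.label (D : Database) (w : Walk) : List Lab :=
  w.steps.map fun p => D.lbl p.1

abbrev RE := RegularExpression Lab

/-- Matches of `R` in `D`: walks in `D` whose label conforms to `R`. -/
def Matches (D : Database) (R : RE) : Set Walk :=
  {w | w.Consistent D ∧ w.label D ∈ R.matches'}

/-- A semantics maps a database and a query to a finite subset of its matches. -/
def IsSemantics (S : Database → RE → Set Walk) : Prop :=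
  ∀ D R, S D R ⊆ Matches D R ∧ (S D R).Finite

/-- `S` is walk-based. -/
def WalkBased (S : Database → RE → Set Walk) : Prop :=
  ∃ r : Set Walk → Set Walk, ∀ D R, S D R = r (Matches D R)

/-- The semantics defined by a filter `f`. -/
def FilterSem (f : Walk → Bool) (D : Database) (R : RE) : Set Walk :=
  {w ∈ Matches D R | f w = true}

/-- Componentwise inclusion of databases. -/
def Database.Sub (D D' : Database) : Prop :=
  D.labels ⊆ D'.labels ∧ D.verts ⊆ D'.verts ∧ D.edges ⊆ D'.edges ∧
    ∀ e ∈ D.edges, D'.src e = D.src e ∧ D'.tgt e = D.tgt e ∧ D'.lbl e = D.lbl e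

def IsPartialOrderRel (le : Walk → Walk → Prop) : Prop :=
  (∀ w, le w w) ∧ (∀ a b c, le a b → le b c → le a c) ∧ ∀ a b, le a b → le b a → a = b

/-- `le` is a well-partial-order on the walks of `D`. -/
def IsWpoOn (le : Walk → Walk → Prop) (D : Database) : Prop :=
  ∀ f : ℕ → Walk, (∀ n, (f n).Consistent D) → ∃ i j, i < j ∧ le (f i) (f j)

/-- Suitable order: a partial order on walks that is a wpo on `Walks D` for each `D`. -/
def Suitable (le : Walk → Walk → Prop) : Prop :=
  IsPartialOrderRel le ∧ ∀ D, IsWpoOn le D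

/-- The semantics based on the order `le`: the `le`-minimal matches among those
with the same endpoints. -/
def OrderSem (le : Walk → Walk → Prop) (D : Database) (R : RE) : Set Walk :=
  {w ∈ Matches D R | ∀ w' ∈ Matches D R, w'.ep = w.ep → le w' w → w' = w}

def Monotonous (S : Database → RE → Set Walk) : Prop :=
  ∀ D D' R, D.Sub D' → S D R ⊆ S D' R

def CoMonotonous (S : Database → RE → Set Walk) : Prop :=
  ∀ D D' R, D.Sub D' → S D' R ∩ Walks D ⊆ S D R

def Stabilizing (S : Database → RE → Set Walk) : Prop :=
  ∀ (D : Database) (Rs : ℕ → RE),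
    (∀ i j, i ≤ j → ∀ u, u ∈ (Rs i).matches' → u ∈ (Rs j).matches') →
    ∃ N, ∀ n, N ≤ n → S D (Rs n) = S D (Rs N)

/-- Concatenation lifted to sets of walks. -/
def setConcat (W W' : Set Walk) : Set Walk :=
  {u | ∃ w ∈ W, ∃ w' ∈ W', w.tgt = w'.src ∧ u = w.concat w'}

/-- `setStar W` : all concatenations `w₁·…·w_k` (k ≥ 1) of walks of `W`. -/
inductive setStar (W : Set Walk) : Walk → Prop
  | base : ∀ w ∈ W, setStar W w
  | step : ∀ u w, setStar W u → w ∈ W → u.tgt = w.src → setStar W (u.concat w)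

/-- Walks jointly consistent with some database. -/
def ConsistentPair (w w' : Walk) : Prop :=
  ∃ D : Database, w.Consistent D ∧ w'.Consistent D

/-- The trimming of an order. -/
def trimRel (le : Walk → Walk → Prop) (w w' : Walk) : Prop :=
  ConsistentPair w w' ∧ w.ep = w'.ep ∧ le w w'

def Trimmed (le : Walk → Walk → Prop) : Prop := trimRel le = le

/-- `le` respects element inclusion. -/
def RespectsElemIncl (le : Walk → Walk → Prop) : Prop :=
  ∀ w w', le w w' →
    (∀ v ∈ w.vertexList, v ∈ w'.vertexList) ∧ ∀ e ∈ w.edgeList, e ∈ w'.edgeList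

/-- Action of a relabeling on a database. -/
def Database.relabel (π : Equiv.Perm Lab) (D : Database) : Database where
  labels := D.labels.image (⇑π)
  verts := D.verts
  edges := D.edges
  src := D.src
  tgt := D.tgt
  lbl := fun e => π (D.lbl e)
  src_mem := D.src_mem
  tgt_mem := D.tgt_mem
  lbl_mem := fun e he => Finset.mem_image_of_mem (⇑π) (D.lbl_mem e he)

/-- Action of a renaming on a walk. -/
def Walk.rename (νv : Equiv.Perm V) (νe : Equiv.Perm Edg) (w : Walk) : Walk :=
  ⟨νv w.head, w.steps.map fun p => (νe p.1, νv p.2)⟩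

/-- Action of a renaming on a database. -/
def Database.rename (νv : Equiv.Perm V) (νe : Equiv.Perm Edg) (D : Database) :
    Database where
  labels := D.labels
  verts := D.verts.image (⇑νv)
  edges := D.edges.image (⇑νe)
  src := fun e => νv (D.src (νe.symm e))
  tgt := fun e => νv (D.tgt (νe.symm e))
  lbl := fun e => D.lbl (νe.symm e)
  src_mem := by
    intro e he
    obtain ⟨e', he', rfl⟩ := Finset.mem_image.mp he
    simpa using Finset.mem_image_of_mem (⇑νv) (D.src_mem e' he')
  tgt_mem := by
    intro e he
    obtain ⟨e', he', rfl⟩ := Finset.mem_image.mp he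
    simpa using Finset.mem_image_of_mem (⇑νv) (D.tgt_mem e' he')
  lbl_mem := by
    intro e he
    obtain ⟨e', he', rfl⟩ := Finset.mem_image.mp he
    simpa using D.lbl_mem e' he'

/-- Identifier independence. -/
def IdIndependent (S : Database → RE → Set Walk) : Prop :=
  ∀ (νv : Equiv.Perm V) (νe : Equiv.Perm Edg) (D : Database) (R : RE),
    Walk.rename νv νe '' S D R = S (Database.rename νv νe D) R

/-- Unbounded semantics. -/
def Unbounded (S : Database → RE → Set Walk) : Prop :=
  ∀ n : ℕ, ∃ (D : Database) (R : RE) (w : Walk), w ∈ S D R ∧ n ≤ w.length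

/-- Shortest-walk semantics. -/
def Sh (D : Database) (R : RE) : Set Walk :=
  {w ∈ Matches D R | ∀ w' ∈ Matches D R, w'.ep = w.ep → w.length ≤ w'.length}

/-- The factor-inserting relation `F`. -/
def FactorIns (w w' : Walk) : Prop :=
  ∃ w₁ w₂ w₃ : Walk, w₁.tgt = w₂.src ∧ w₂.tgt = w₃.src ∧ w₁.tgt = w₃.src ∧
    w = w₁.concat w₃ ∧ w' = (w₁.concat w₂).concat w₃

/-- The subwalk order: reflexive–transitive closure of `FactorIns`. -/
def SubwalkOrd : Walk → Walk → Prop := Relation.ReflTransGen FactorIns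

/-- The regular expression denoting a single word. -/
def wordRE : List Lab → RE
  | [] => 1
  | a :: l => RegularExpression.char a * wordRE l

theorem mem_matches_wordRE (l : List Lab) : l ∈ (wordRE l).matches' := by
  induction l with
  | nil => simp [wordRE, RegularExpression.matches'_epsilon]
  | cons a l ih =>
    rw [wordRE, RegularExpression.matches'_mul]
    exact Language.mem_mul.2 ⟨[a], Set.mem_singleton [a], l, ih, rfl⟩

theorem Walk.Consistent.mono {D D' : Database} (h : D.Sub D') {w : Walk}
    (hw : w.Consistent D) : w.Consistent D' := by
  obtain ⟨-, hv, he, heq⟩ := h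
  have key : ∀ (l : List (Edg × V)) (v : V), chainFrom D v l → chainFrom D' v l := by
    intro l
    induction l with
    | nil => exact fun _ _ => trivial
    | cons p l ih =>
      rintro v ⟨h₁, h₂, h₃, h₄⟩
      obtain ⟨k₁, k₂, -⟩ := heq _ h₁
      exact ⟨he h₁, k₁.trans h₂, k₂.trans h₃, ih _ h₄⟩
  exact ⟨hv hw.1, key _ _ hw.2⟩

theorem Walk.tgt_concat {w w' : Walk} (h : w.tgt = w'.src) : (w.concat w').tgt = w'.tgt := by
  rcases w with ⟨v, l⟩
  rcases w' with ⟨v', l'⟩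
  rcases List.eq_nil_or_concat l' with rfl | ⟨l'', p, rfl⟩
  · simpa [Walk.concat, Walk.tgt, Walk.src] using h
  · simp [Walk.concat, Walk.tgt, ← List.append_assoc]

theorem Walk.tgt_rename (νv : Equiv.Perm V) (νe : Equiv.Perm Edg) (w : Walk) :
    (w.rename νv νe).tgt = νv w.tgt := by
  rcases w with ⟨v, l⟩
  rcases List.eq_nil_or_concat l with rfl | ⟨l', p, rfl⟩ <;> simp [Walk.rename, Walk.tgt]

theorem exists_perm_disjoint_image (E : Finset Edg) :
    ∃ ν : Equiv.Perm Edg, ∀ e ∈ E, ν e ∉ E := by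
  obtain ⟨N, hN⟩ : ∃ N, ∀ e ∈ E, e < N :=
    ⟨E.sup id + 1, fun e he => Nat.lt_succ_of_le (Finset.le_sup (f := id) he)⟩
  have hinv : Function.Involutive
      (fun e : ℕ => if e < N then e + N else if e < 2 * N then e - N else e) := by
    intro e
    dsimp only
    split_ifs <;> omega
  refine ⟨hinv.toPerm, fun e he he' => ?_⟩
  have h₂ := hN _ he'
  simp [hN e he] at h₂

/-- The union of two databases, reading the edges they share as in the first one. -/
def Database.union (D D' : Database) : Database where
  labels := D.labels ∪ D'.labels
  verts := D.verts ∪ D'.verts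
  edges := D.edges ∪ D'.edges
  src := fun e => if e ∈ D.edges then D.src e else D'.src e
  tgt := fun e => if e ∈ D.edges then D.tgt e else D'.tgt e
  lbl := fun e => if e ∈ D.edges then D.lbl e else D'.lbl e
  src_mem := by
    intro e he
    have := D.src_mem e
    have := D'.src_mem e
    grind
  tgt_mem := by
    intro e he
    have := D.tgt_mem e
    have := D'.tgt_mem e
    grind
  lbl_mem := by
    intro e he
    have := D.lbl_mem e
    have := D'.lbl_mem e
    grind

theorem Database.sub_union_left (D D' : Database) : D.Sub (D.union D') :=
  ⟨Finset.subset_union_left, Finset.subset_union_left, Finset.subset_union_left,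
    fun e he => by simp [Database.union, he]⟩

theorem Database.sub_union_right {D D' : Database} (h : Disjoint D.edges D'.edges) :
    D'.Sub (D.union D') :=
  ⟨Finset.subset_union_right, Finset.subset_union_right, Finset.subset_union_right,
    fun e he => by simp [Database.union, Finset.disjoint_right.1 h he]⟩

/-- The walk going `n + 1` times through `w`. -/
def Walk.powSucc (w : Walk) : ℕ → Walk
  | 0 => w
  | n + 1 => (w.powSucc n).concat w

theorem Walk.tgt_powSucc {w : Walk} (h : w.tgt = w.src) (n : ℕ) :
    (w.powSucc n).tgt = w.src := by
  induction n with
  | zero => exact h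
  | succ n ih => exact (Walk.tgt_concat ih).trans h

theorem Walk.length_powSucc (w : Walk) (n : ℕ) :
    (w.powSucc n).length = (n + 1) * w.length := by
  induction n with
  | zero => simp [Walk.powSucc]
  | succ n ih =>
    have : (w.powSucc (n + 1)).length = (w.powSucc n).length + w.length := by
      simp [Walk.powSucc, Walk.concat, Walk.length]
    rw [this, ih]
    ring

theorem Walk.label_powSucc_mem_star (D : Database) (w : Walk) (n : ℕ) :
    (w.powSucc n).label D ∈ (RegularExpression.star (wordRE (w.label D))).matches' := by
  have h : (w.powSucc n).label D = (List.replicate (n + 1) (w.label D)).flatten := by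
    induction n with
    | zero => simp [Walk.powSucc]
    | succ n ih =>
      have : (w.powSucc (n + 1)).label D = (w.powSucc n).label D ++ w.label D := by
        simp [Walk.powSucc, Walk.concat, Walk.label]
      rw [this, ih, List.replicate_succ' (n := n + 1)]
      simp
  rw [RegularExpression.matches'_star, Language.mem_kstar]
  refine ⟨_, h, fun y hy => ?_⟩
  rw [List.eq_of_mem_replicate hy]
  exact mem_matches_wordRE _

/-- No identifier-independent, unbounded, filter-based semantics is ·-composable. -/
theorem no_filterBased_concatComposable
    (S : Database → RE → Set Walk) (hS : IsSemantics S) (f : Walk → Bool)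
    (hf : ∀ D R, S D R = FilterSem f D R)
    (hid : IdIndependent S) (hub : Unbounded S) :
    ∃ (D : Database) (R R' : RE),
      ¬ (setConcat (S D R) (S D R') ⊆ S D (R * R')) := by
  by_contra! hcomp
  have mem_S {D : Database} {R : RE} {w : Walk} :
      w ∈ S D R ↔ (w.Consistent D ∧ w.label D ∈ R.matches') ∧ f w = true := by
    rw [hf]; rfl
  have concat_accepted {D : Database} {w w' : Walk}
      (hw : w.Consistent D ∧ f w = true) (hw' : w'.Consistent D ∧ f w' = true)
      (h : w.tgt = w'.src) : (w.concat w').Consistent D ∧ f (w.concat w') = true := by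
    have := mem_S.1 (hcomp D (wordRE (w.label D)) (wordRE (w'.label D))
      ⟨w, mem_S.2 ⟨⟨hw.1, mem_matches_wordRE _⟩, hw.2⟩,
        w', mem_S.2 ⟨⟨hw'.1, mem_matches_wordRE _⟩, hw'.2⟩, h, rfl⟩)
    exact ⟨this.1.1, this.2⟩
  have closed_length {D : Database} {c : Walk} (hc : c.Consistent D ∧ f c = true)
      (h : c.tgt = c.src) : c.length = 0 := by
    by_contra hlen
    have pow_accepted (n : ℕ) : (c.powSucc n).Consistent D ∧ f (c.powSucc n) = true := by
      induction n with
      | zero => exact hc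
      | succ n ih => exact concat_accepted ih hc (Walk.tgt_powSucc h n)
    have hinj : Function.Injective c.powSucc := by
      intro m n hmn
      have := congrArg Walk.length hmn
      rw [Walk.length_powSucc, Walk.length_powSucc] at this
      exact Nat.succ_injective (Nat.eq_of_mul_eq_mul_right (Nat.pos_of_ne_zero hlen) this)
    exact Set.infinite_of_injective_forall_mem hinj
      (fun n => mem_S.2 ⟨⟨(pow_accepted n).1, Walk.label_powSucc_mem_star D c n⟩,
        (pow_accepted n).2⟩) (hS D _).2
  obtain ⟨D, R, w, hw, hlen⟩ := hub 1
  obtain ⟨νe, hνe⟩ := exists_perm_disjoint_image D.edges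
  let νv : Equiv.Perm V := Equiv.swap w.src w.tgt
  have hw' : w.rename νv νe ∈ S (D.rename νv νe) R :=
    hid νv νe D R ▸ Set.mem_image_of_mem _ hw
  have hdisj : Disjoint D.edges (D.rename νv νe).edges := by
    rw [Finset.disjoint_right]
    intro e he
    obtain ⟨e', he', rfl⟩ := Finset.mem_image.1 he
    exact hνe e' he'
  have hw := mem_S.1 hw
  have hw' := mem_S.1 hw'
  have hsrc : w.tgt = (w.rename νv νe).src := (Equiv.swap_apply_left w.src w.tgt).symm
  have htgt : (w.concat (w.rename νv νe)).tgt = (w.concat (w.rename νv νe)).src := by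
    rw [Walk.tgt_concat hsrc, Walk.tgt_rename]
    exact Equiv.swap_apply_right w.src w.tgt
  have h0 := closed_length (concat_accepted
    ⟨hw.1.1.mono (D.sub_union_left (D.rename νv νe)), hw.2⟩
    ⟨hw'.1.1.mono (Database.sub_union_right hdisj), hw'.2⟩ hsrc) htgt
  simp only [Walk.length, Walk.concat, List.length_append] at h0 hlen
  omega

end RPQ
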